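/- Suppose s_0s_1 = g_1⋯g_r in G = ℤ/2 * ℤ/3, where each g_i is a conjugate of s_1 = bwb. Then r ≥ 2, and a finite sequence of Hurwitz moves transforms the sequence (g_1,…,g_r) into a sequence (g_1',…,g_r') of conjugates of s_1 with g_1' = s_0, g_2' = s_1, and g_3'⋯g_r' = 1. -/

import Mathlib

/-- `G = ℤ/2 * ℤ/3`, the free product of cyclic groups of orders 2 and 3
(isomorphic to `PSL(2,ℤ)`). -/
abbrev G23 := Monoid.Coprod (Multiplicative (ZMod 2)) (Multiplicative (ZMod 3))

/-- The generator `w` of the `ℤ/2` factor. -/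
def w : G23 := Monoid.Coprod.inl (Multiplicative.ofAdd (1 : ZMod 2))

/-- The generator `b` of the `ℤ/3` factor. -/
def b : G23 := Monoid.Coprod.inr (Multiplicative.ofAdd (1 : ZMod 3))

/-- `s₀ = wb²`. -/
def s0 : G23 := w * b ^ 2

/-- `s₁ = bwb`. -/
def s1 : G23 := b * w * b

/-- `s₂ = b²w`. -/
def s2 : G23 := b ^ 2 * w

/-- A single Hurwitz move on a finite sequence of elements of a group: some consecutive
pair `(a, b)` is replaced by `(b, b⁻¹ * a * b)` or by `(a * b * a⁻¹, a)`. -/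
def HurwitzMove {G : Type*} [Group G] (L L' : List G) : Prop :=
  ∃ (p : List G) (x y : G) (t : List G),
    L = p ++ x :: y :: t ∧
    (L' = p ++ y :: (y⁻¹ * x * y) :: t ∨ L' = p ++ (x * y * x⁻¹) :: x :: t)

/-- A finite sequence of Hurwitz moves. -/
def HurwitzEquiv {G : Type*} [Group G] : List G → List G → Prop :=
  Relation.ReflTransGen HurwitzMove

/-- The power of `b` with exponent in `ZMod 3`. -/
def bPow (k : ZMod 3) : G23 := Monoid.Coprod.inr (Multiplicative.ofAdd k)

theorem bPow_zero : bPow 0 = 1 := map_one _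

theorem bPow_add (j k : ZMod 3) : bPow (j + k) = bPow j * bPow k :=
  map_mul Monoid.Coprod.inr (Multiplicative.ofAdd j) (Multiplicative.ofAdd k)

theorem bPow_one : bPow 1 = b := rfl

theorem bPow_two : bPow 2 = b⁻¹ := by
  rw [eq_inv_iff_mul_eq_one, ← bPow_one, ← bPow_add, ← bPow_zero]; rfl

theorem inv_bPow (k : ZMod 3) : (bPow k)⁻¹ = bPow (-k) := by
  rw [inv_eq_iff_mul_eq_one, ← bPow_add, add_neg_cancel, bPow_zero]

theorem w_mul_w : w * w = 1 := by
  rw [w, ← map_mul, ← map_one Monoid.Coprod.inl]; rfl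

theorem inv_w : w⁻¹ = w := inv_eq_of_mul_eq_one_left w_mul_w

theorem w_mul_w_mul (x : G23) : w * (w * x) = x := by
  rw [← mul_assoc, w_mul_w, one_mul]

theorem b_mul_b : b * b = b⁻¹ := by
  rw [← bPow_one, ← bPow_add, bPow_one, ← bPow_two]; rfl

theorem b_mul_b_mul (x : G23) : b * (b * x) = b⁻¹ * x := by
  rw [← mul_assoc, b_mul_b]

theorem inv_b_mul_inv_b : b⁻¹ * b⁻¹ = b := by
  rw [← mul_inv_rev, b_mul_b, inv_inv]

/-- Vertices of the trivalent Bass–Serre tree, that is, left cosets of `⟨b⟩`: `root` is `⟨b⟩` and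
`node e [c₁, …, cₙ]` is `b ^ e * w * b ^ c₁ * w * ⋯ * b ^ cₙ * w * ⟨b⟩`. -/
inductive TreeVertex
  | root
  | node (e : ZMod 3) (l : List {c : ZMod 3 // c ≠ 0})

namespace TreeVertex

/-- The distance to the root. -/
def depth : TreeVertex → ℕ
  | root => 0
  | node _ l => l.length + 1

theorem depth_node (e : ZMod 3) (l : List {c : ZMod 3 // c ≠ 0}) :
    (node e l).depth = l.length + 1 := rfl

/-- The vertices whose normal form starts with `w`. -/
def HeadZero : TreeVertex → Prop
  | root => False
  | node e _ => e = 0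

/-- The action of `w`. -/
def wAct : Function.End TreeVertex
  | root => node 0 []
  | node e l => if h : e = 0 then (match l with | [] => root | c :: l => node c l)
      else node 0 (⟨e, h⟩ :: l)

/-- The action of a power of `b`. -/
def bAct (k : ZMod 3) : Function.End TreeVertex
  | root => root
  | node e l => node (k + e) l

theorem wAct_wAct (v : TreeVertex) : wAct (wAct v) = v := by
  rcases v with _ | ⟨e, l⟩
  · simp [wAct]
  · by_cases h : e = 0
    · subst h
      rcases l with _ | ⟨c, l⟩
      · simp [wAct]
      · simp [wAct, c.2]
    · simp [wAct, h]

theorem depth_bAct (k : ZMod 3) (v : TreeVertex) : (bAct k v).depth = v.depth := by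
  cases v <;> rfl

theorem wAct_of_not_headZero {v : TreeVertex} (h : ¬ v.HeadZero) :
    ∃ l, wAct v = node 0 l ∧ l.length = v.depth := by
  rcases v with _ | ⟨e, l⟩
  · exact ⟨[], rfl, rfl⟩
  · have he : e ≠ 0 := h
    exact ⟨⟨e, he⟩ :: l, by simp [wAct, he], rfl⟩

theorem not_headZero_wAct {v : TreeVertex} (h : v.HeadZero) :
    ¬ (wAct v).HeadZero ∧ v.depth = (wAct v).depth + 1 := by
  rcases v with _ | ⟨e, l⟩
  · exact h.elim
  · obtain rfl : e = 0 := h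
    rcases l with _ | ⟨c, l⟩
    · simp [wAct, HeadZero, depth]
    · simp [wAct, HeadZero, depth, c.2]

theorem depth_wAct_le (v : TreeVertex) : (wAct v).depth ≤ v.depth + 1 := by
  by_cases h : v.HeadZero
  · have := (not_headZero_wAct h).2
    omega
  · obtain ⟨l, hl, hd⟩ := wAct_of_not_headZero h
    rw [hl, ← hd, depth]

/-- The element of `G23` spelled by the normal form of a vertex. -/
def eval : TreeVertex → G23
  | root => 1
  | node e l => bPow e * w * (l.map fun c : {c : ZMod 3 // c ≠ 0} => bPow c * w).prod

theorem eval_bAct (k : ZMod 3) (v : TreeVertex) :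
    ∃ j, eval (bAct k v) = bPow k * eval v * bPow j := by
  rcases v with _ | ⟨e, l⟩
  · exact ⟨-k, by simp [bAct, eval, ← bPow_add, bPow_zero]⟩
  · exact ⟨0, by simp [bAct, eval, bPow_add, bPow_zero, mul_assoc]⟩

theorem eval_wAct (v : TreeVertex) : eval (wAct v) = w * eval v := by
  rcases v with _ | ⟨e, l⟩
  · simp [wAct, eval, bPow_zero]
  · by_cases h : e = 0
    · subst h
      rcases l with _ | ⟨c, l⟩ <;>
        simp [wAct, eval, bPow_zero, w_mul_w, w_mul_w_mul, mul_assoc]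
    · simp [wAct, h, eval, bPow_zero, mul_assoc]

/-- The action of `G23` on the tree. -/
def act : G23 →* Function.End TreeVertex :=
  Monoid.Coprod.lift
    { toFun := fun k => if k = 1 then 1 else wAct
      map_one' := if_pos rfl
      map_mul' := by
        have hw : wAct * wAct = 1 :=
          funext wAct_wAct
        have h2 : ∀ k : Multiplicative (ZMod 2), k = 1 ∨ k = Multiplicative.ofAdd 1 := by decide
        have h11 : (Multiplicative.ofAdd (1 : ZMod 2)) * Multiplicative.ofAdd 1 = 1 := by decide
        intro j k
        rcases h2 j with rfl | rfl <;> rcases h2 k with rfl | rfl <;> simp [h11, hw] }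
    { toFun := fun k => bAct k.toAdd
      map_one' := by
        funext v
        cases v <;> simp [bAct, Function.End.one_def]
      map_mul' := by
        intro j k
        funext v
        change bAct (j.toAdd + k.toAdd) v = bAct j.toAdd (bAct k.toAdd v)
        cases v <;> simp [bAct, add_assoc] }

theorem act_w (v : TreeVertex) : act w v = wAct v := by
  have : act w = wAct := by
    rw [act, w, Monoid.Coprod.lift_apply_inl]
    exact if_neg (c := Multiplicative.ofAdd (1 : ZMod 2) = 1) (t := (1 : Function.End TreeVertex))
      (by decide)
  rw [this]

theorem act_bPow (k : ZMod 3) (v : TreeVertex) : act (bPow k) v = bAct k v := by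
  have : act (bPow k) = bAct k := by
    rw [act, bPow, Monoid.Coprod.lift_apply_inr]
    rfl
  rw [this]

theorem act_one (v : TreeVertex) : act 1 v = v := by
  rw [map_one]; rfl

theorem act_mul (x y : G23) (v : TreeVertex) : act (x * y) v = act x (act y v) := by
  rw [map_mul]; rfl

theorem exists_eq_eval_act_mul_bPow (x : G23) (v : TreeVertex) :
    ∃ k, x * eval v = eval (act x v) * bPow k := by
  induction x using Monoid.Coprod.induction_on generalizing v with
  | inl k =>
    have h2 : ∀ k : Multiplicative (ZMod 2), k = 1 ∨ k = Multiplicative.ofAdd 1 := by decide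
    refine ⟨0, ?_⟩
    rcases h2 k with rfl | rfl
    · simp [act_one, bPow_zero]
    · change w * eval v = eval (act w v) * bPow 0
      rw [act_w, eval_wAct, bPow_zero, mul_one]
  | inr k =>
    change ∃ j, bPow k.toAdd * eval v = eval (act (bPow k.toAdd) v) * bPow j
    obtain ⟨j, hj⟩ := eval_bAct k.toAdd v
    exact ⟨-j, by rw [act_bPow, hj, mul_assoc _ (bPow j), ← bPow_add, add_neg_cancel, bPow_zero,
      mul_one]⟩
  | mul x y hx hy =>
    obtain ⟨j, hj⟩ := hy v
    obtain ⟨k, hk⟩ := hx (act y v)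
    exact ⟨k + j, by rw [mul_assoc, hj, ← mul_assoc, hk, act_mul, bPow_add, mul_assoc]⟩

theorem act_eval_node (e k : ZMod 3) (hk : k ≠ 0) (l l' : List {c : ZMod 3 // c ≠ 0}) :
    act (eval (node e l)) (node k l') = node e (l ++ ⟨k, hk⟩ :: l') := by
  induction l generalizing e with
  | nil => simp [eval, act_mul, act_bPow, act_w, wAct, bAct, hk]
  | cons c l ih =>
    have h : eval (node e (c :: l)) = bPow e * w * eval (node c l) := by
      simp [eval, mul_assoc]
    rw [h, act_mul, ih]
    simp [act_mul, act_bPow, act_w, wAct, bAct, c.2]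

theorem depth_act_eval_le (v u : TreeVertex) :
    (act (eval v) u).depth ≤ v.depth + u.depth := by
  rcases v with _ | ⟨e, l⟩
  · simp [eval, act_one, depth]
  induction l generalizing e with
  | nil =>
    have := depth_wAct_le u
    simp only [eval, List.map_nil, List.prod_nil, mul_one, act_mul, act_bPow, act_w, depth_bAct]
    simp only [depth_node, List.length_nil]
    omega
  | cons c l ih =>
    have h : eval (node e (c :: l)) = bPow e * w * eval (node c l) := by
      simp [eval, mul_assoc]
    have h1 := ih c
    have h2 := depth_wAct_le (act (eval (node c l)) u)
    rw [h, act_mul, act_mul, act_bPow, depth_bAct, act_w]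
    simp only [depth_node, List.length_cons] at *
    omega

theorem depth_act_inv_eval_le (v u : TreeVertex) :
    (act (eval v)⁻¹ u).depth ≤ v.depth + u.depth := by
  rcases v with _ | ⟨e, l⟩
  · simp [eval, act_one, depth]
  induction l generalizing e u with
  | nil =>
    have := depth_wAct_le (bAct (-e) u)
    rw [depth_bAct] at this
    simp only [eval, List.map_nil, List.prod_nil, mul_one, mul_inv_rev, inv_w, inv_bPow, act_mul,
      act_bPow, act_w]
    simp only [depth_node, List.length_nil]
    omega
  | cons c l ih =>
    have h : eval (node e (c :: l)) = bPow e * w * eval (node c l) := by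
      simp [eval, mul_assoc]
    have h1 := ih (wAct (bAct (-e) u)) c
    have h2 := depth_wAct_le (bAct (-e) u)
    rw [depth_bAct] at h2
    rw [h, mul_inv_rev, mul_inv_rev, inv_w, inv_bPow, act_mul, act_mul, act_bPow, act_w]
    simp only [depth_node, List.length_cons] at *
    omega

end TreeVertex

open TreeVertex

/-- The number of letters `w` in the normal form of an element. -/
def wLength (x : G23) : ℕ := (act x root).depth

/-- The normal form of the element starts with `w`. -/
def StartsW (x : G23) : Prop := (act x root).HeadZero

theorem exists_eq_eval_mul_bPow (x : G23) : ∃ k, x = eval (act x root) * bPow k := by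
  simpa [eval] using exists_eq_eval_act_mul_bPow x root

theorem wLength_mul_le (x y : G23) : wLength (x * y) ≤ wLength x + wLength y := by
  obtain ⟨k, hk⟩ := exists_eq_eval_mul_bPow x
  have := depth_act_eval_le (act x root) (bAct k (act y root))
  rw [depth_bAct, ← act_bPow, ← act_mul, ← hk, ← act_mul] at this
  exact this

theorem wLength_inv_le (x : G23) : wLength x⁻¹ ≤ wLength x := by
  obtain ⟨k, hk⟩ := exists_eq_eval_mul_bPow x
  have h := depth_act_inv_eval_le (act x root) root
  have hx : x⁻¹ = bPow (-k) * (eval (act x root))⁻¹ := by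
    conv_lhs => rw [hk]
    rw [mul_inv_rev, inv_bPow]
  rw [wLength, hx, act_mul, act_bPow, depth_bAct]
  exact h

theorem wLength_inv (x : G23) : wLength x⁻¹ = wLength x :=
  le_antisymm (wLength_inv_le x) (by simpa using wLength_inv_le x⁻¹)

theorem wLength_bPow_mul (k : ZMod 3) (x : G23) : wLength (bPow k * x) = wLength x := by
  rw [wLength, act_mul, act_bPow, depth_bAct, wLength]

theorem wLength_b_mul (x : G23) : wLength (b * x) = wLength x := wLength_bPow_mul 1 x

theorem wLength_inv_b_mul (x : G23) : wLength (b⁻¹ * x) = wLength x := by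
  rw [← bPow_two, wLength_bPow_mul]

theorem wLength_mul_b (x : G23) : wLength (x * b) = wLength x := by
  rw [← wLength_inv, mul_inv_rev, wLength_inv_b_mul, wLength_inv]

theorem wLength_mul_inv_b (x : G23) : wLength (x * b⁻¹) = wLength x := by
  rw [← wLength_inv, mul_inv_rev, inv_inv, wLength_b_mul, wLength_inv]

theorem wLength_b : wLength b = 0 := by
  have h := wLength_b_mul 1
  rw [mul_one] at h
  rw [h, wLength, act_one, depth]

theorem StartsW.exists_eq_w_mul {x : G23} (h : StartsW x) :
    ∃ y, x = w * y ∧ ¬ StartsW y ∧ wLength x = wLength y + 1 := by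
  have := not_headZero_wAct h
  rw [← act_w, ← act_mul] at this
  exact ⟨w * x, (w_mul_w_mul x).symm, this⟩

theorem startsW_of_wLength_lt {x : G23} (h : wLength (w * x) < wLength x) : StartsW x := by
  by_contra hx
  obtain ⟨l, hl, hd⟩ := wAct_of_not_headZero hx
  rw [wLength, act_mul, act_w, hl, depth, hd] at h
  exact absurd h (by simp [wLength])

theorem exists_eval_node_eq_mul_w (e : ZMod 3) (l : List {c : ZMod 3 // c ≠ 0}) :
    ∃ z, eval (node e l) = z * w ∧ wLength z ≤ l.length := by
  induction l generalizing e with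
  | nil => exact ⟨bPow e, by simp [eval], by rw [wLength, act_bPow]; rfl⟩
  | cons c l ih =>
    obtain ⟨z, hz, hl⟩ := ih c
    refine ⟨bPow e * (w * z), by rw [mul_assoc, mul_assoc, ← hz]; simp [eval, mul_assoc], ?_⟩
    have := depth_wAct_le (act z root)
    rw [← act_w, ← act_mul] at this
    rw [wLength_bPow_mul]
    exact this.trans (Nat.succ_le_succ hl)

/-- Either `x` is a power of `b` or the normal form of `x` ends with a nontrivial power of `b`. -/
theorem exists_eq_bPow_or_of_not_startsW_inv {x : G23} (h : ¬ StartsW x⁻¹) :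
    (∃ k, x = bPow k) ∨
      ∃ e l k, k ≠ 0 ∧ act x root = node e l ∧ x = eval (node e l) * bPow k := by
  obtain ⟨k, hk⟩ := exists_eq_eval_mul_bPow x
  rcases hv : act x root with _ | ⟨e, l⟩
  · rw [hv] at hk
    exact .inl ⟨k, by rw [hk, eval, one_mul]⟩
  · rw [hv] at hk
    refine .inr ⟨e, l, k, ?_, rfl, hk⟩
    rintro rfl
    obtain ⟨z, hz, hl⟩ := exists_eval_node_eq_mul_w e l
    refine h (startsW_of_wLength_lt ?_)
    have hx : w * x⁻¹ = z⁻¹ := by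
      rw [hk, hz, bPow_zero, mul_one, mul_inv_rev, inv_w, w_mul_w_mul]
    rw [hx, wLength_inv, wLength_inv, wLength, wLength, hv, depth]
    exact Nat.lt_succ_of_le hl

theorem wLength_mul_w_mul {x y : G23} (hx : ¬ StartsW x⁻¹) (hy : ¬ StartsW y) :
    wLength (x * w * y) = wLength x + wLength y + 1 := by
  obtain ⟨l', hl', hd⟩ := wAct_of_not_headZero hy
  rcases exists_eq_bPow_or_of_not_startsW_inv hx with ⟨k, rfl⟩ | ⟨e, l, k, hk, hv, hxe⟩
  · rw [mul_assoc, wLength_bPow_mul, wLength, act_mul, act_w, hl', wLength, wLength, act_bPow,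
      depth, hd]
    simp [bAct, depth]
  · have : act (x * w * y) root = node e (l ++ ⟨k, hk⟩ :: l') := by
      rw [hxe, act_mul, act_mul, act_mul, act_w, hl', act_bPow, bAct, add_zero, act_eval_node]
    rw [wLength, wLength, wLength, this, hv]
    simp only [depth_node, List.length_append, List.length_cons]
    omega

theorem not_startsW_mul_w_mul {x y : G23} (hx1 : x ≠ 1) (hx : ¬ StartsW x)
    (hx' : ¬ StartsW x⁻¹) (hy : ¬ StartsW y) : ¬ StartsW (x * w * y) := by
  obtain ⟨l', hl', -⟩ := wAct_of_not_headZero hy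
  rcases exists_eq_bPow_or_of_not_startsW_inv hx' with ⟨k, rfl⟩ | ⟨e, l, k, hk, hv, hxe⟩
  · rw [StartsW, act_mul, act_mul, act_w, hl', act_bPow, bAct, add_zero]
    rintro rfl
    exact hx1 bPow_zero
  · have : act (x * w * y) root = node e (l ++ ⟨k, hk⟩ :: l') := by
      rw [hxe, act_mul, act_mul, act_mul, act_w, hl', act_bPow, bAct, add_zero, act_eval_node]
    rw [StartsW, this]
    rwa [StartsW, hv] at hx

theorem exists_eq_bPow {x : G23} (h0 : ¬ StartsW x) (h1 : ¬ StartsW (b * x))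
    (h2 : ¬ StartsW (b⁻¹ * x)) : ∃ k, x = bPow k := by
  obtain ⟨k, hk⟩ := exists_eq_eval_mul_bPow x
  rw [← bPow_one] at h1
  rw [← bPow_two] at h2
  rw [StartsW, act_mul, act_bPow] at h1 h2
  rw [StartsW] at h0
  rcases hv : act x root with _ | ⟨e, l⟩
  · rw [hv] at hk
    exact ⟨k, by rw [hk, eval, one_mul]⟩
  · rw [hv] at h0 h1 h2
    have he : ∀ e : ZMod 3, e = 0 ∨ 1 + e = 0 ∨ 2 + e = 0 := by decide
    rcases he e with h | h | h
    exacts [(h0 h).elim, (h1 h).elim, (h2 h).elim]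

theorem HurwitzMove.prod_eq {G : Type*} [Group G] {L L' : List G} (h : HurwitzMove L L') :
    L'.prod = L.prod := by
  obtain ⟨p, x, y, t, rfl, rfl | rfl⟩ := h <;> simp [mul_assoc]

theorem HurwitzMove.length_eq {G : Type*} [Group G] {L L' : List G} (h : HurwitzMove L L') :
    L'.length = L.length := by
  obtain ⟨p, x, y, t, rfl, rfl | rfl⟩ := h <;> simp

theorem HurwitzMove.forall_isConj {G : Type*} [Group G] {L L' : List G} {s : G}
    (h : HurwitzMove L L') (hL : ∀ g ∈ L, IsConj s g) : ∀ g ∈ L', IsConj s g := by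
  obtain ⟨p, x, y, t, rfl, rfl | rfl⟩ := h
  · have hx : IsConj x (y⁻¹ * x * y) := isConj_iff.2 ⟨y⁻¹, by simp⟩
    have := (hL x (by simp)).trans hx
    grind
  · have hy : IsConj y (x * y * x⁻¹) := isConj_iff.2 ⟨x, rfl⟩
    have := (hL y (by simp)).trans hy
    grind

theorem HurwitzMove.cons {G : Type*} [Group G] {L L' : List G} (g : G) (h : HurwitzMove L L') :
    HurwitzMove (g :: L) (g :: L') := by
  obtain ⟨p, x, y, t, rfl, h⟩ := h
  exact ⟨g :: p, x, y, t, rfl, by simpa using h⟩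

theorem HurwitzEquiv.prod_eq {G : Type*} [Group G] {L L' : List G} (h : HurwitzEquiv L L') :
    L'.prod = L.prod := by
  induction h with
  | refl => rfl
  | tail _ h ih => rw [h.prod_eq, ih]

theorem HurwitzEquiv.length_eq {G : Type*} [Group G] {L L' : List G} (h : HurwitzEquiv L L') :
    L'.length = L.length := by
  induction h with
  | refl => rfl
  | tail _ h ih => rw [h.length_eq, ih]

theorem HurwitzEquiv.forall_isConj {G : Type*} [Group G] {L L' : List G} {s : G}
    (h : HurwitzEquiv L L') (hL : ∀ g ∈ L, IsConj s g) : ∀ g ∈ L', IsConj s g := by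
  induction h with
  | refl => exact hL
  | tail _ h ih => exact h.forall_isConj ih

theorem HurwitzEquiv.cons {G : Type*} [Group G] {L L' : List G} (g : G) (h : HurwitzEquiv L L') :
    HurwitzEquiv (g :: L) (g :: L') :=
  h.lift (g :: ·) fun _ _ h => h.cons g

/-- An entry can be moved to the front at the cost of conjugating the entries it passes. -/
theorem hurwitzEquiv_move_front {G : Type*} [Group G] (p : List G) (x : G) (t : List G) :
    HurwitzEquiv (p ++ x :: t) (x :: (p.map (fun g => x⁻¹ * g * x) ++ t)) := by
  induction p with
  | nil => exact .refl
  | cons g p ih => exact (ih.cons g).tail ⟨[], g, x, _, rfl, .inl rfl⟩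

/-- The conjugate of `s1` by `Q⁻¹`. -/
def s1Conj (Q : G23) : G23 := Q⁻¹ * s1 * Q

theorem s1_eq : s1 = b * (w * b) := mul_assoc _ _ _

theorem s1Conj_s1_mul (Q : G23) : s1Conj (s1 * Q) = s1Conj Q := by
  simp [s1Conj, mul_assoc]

theorem s1Conj_inv_s1_mul (Q : G23) : s1Conj (s1⁻¹ * Q) = s1Conj Q := by
  simp [s1Conj, mul_assoc]

theorem wLength_s1_mul_lt {Q : G23} (h : StartsW (b * Q)) : wLength (s1 * Q) < wLength Q := by
  obtain ⟨y, hy, -, hl⟩ := h.exists_eq_w_mul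
  rw [wLength_b_mul] at hl
  rw [s1_eq, mul_assoc, mul_assoc, hy, w_mul_w_mul, wLength_b_mul, hl]
  exact Nat.lt_succ_self _

theorem wLength_inv_s1_mul_lt {Q : G23} (h : StartsW (b⁻¹ * Q)) :
    wLength (s1⁻¹ * Q) < wLength Q := by
  obtain ⟨y, hy, -, hl⟩ := h.exists_eq_w_mul
  rw [wLength_inv_b_mul] at hl
  rw [s1_eq, mul_inv_rev, mul_inv_rev, inv_w, mul_assoc, mul_assoc, hy, w_mul_w_mul,
    wLength_inv_b_mul, hl]
  exact Nat.lt_succ_self _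

/-- The part of the product `s1Conj Q * s1Conj R` between the central letters `w` of the
two factors. -/
def middle (Q R : G23) : G23 := b * Q * R⁻¹ * b

theorem wLength_mul_inv_s1Conj_lt {Q R : G23} (hQ : ¬ StartsW (b * Q))
    (h : StartsW (middle Q R)) : wLength (R * (s1Conj Q)⁻¹) < wLength R := by
  obtain ⟨y, hy, hyw, -⟩ := h.exists_eq_w_mul
  have hR : R⁻¹ * b = (b * Q)⁻¹ * w * y := by
    rw [mul_assoc, ← hy]; simp [middle, mul_assoc]
  have hlen := wLength_mul_w_mul (x := (b * Q)⁻¹) (by rwa [inv_inv]) hyw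
  rw [← hR, wLength_mul_b, wLength_inv, wLength_inv, wLength_b_mul] at hlen
  have hnew : (R * (s1Conj Q)⁻¹)⁻¹ = Q⁻¹ * b * y * b⁻¹ := by
    rw [← w_mul_w_mul y, ← hy]
    simp [middle, s1Conj, s1_eq, mul_assoc]
  have h1 := wLength_mul_le (Q⁻¹ * b) y
  rw [wLength_mul_b, wLength_inv] at h1
  rw [← wLength_inv, hnew, wLength_mul_inv_b]
  omega

theorem wLength_mul_s1Conj_lt {Q R : G23} (hR : ¬ StartsW (b⁻¹ * R))
    (h : StartsW (middle Q R)⁻¹) : wLength (Q * s1Conj R) < wLength Q := by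
  obtain ⟨y, hy, hyw, -⟩ := h.exists_eq_w_mul
  have hm : middle Q R = y⁻¹ * w := by
    rw [← inv_inv (middle Q R), hy, mul_inv_rev, inv_w]
  have hQ : b * Q = y⁻¹ * w * (b⁻¹ * R) := by
    rw [← hm]; simp [middle, mul_assoc]
  have hlen := wLength_mul_w_mul (x := y⁻¹) (by rwa [inv_inv]) hR
  rw [← hQ, wLength_b_mul, wLength_inv, wLength_inv_b_mul] at hlen
  have hnew : Q * s1Conj R = b⁻¹ * (y⁻¹ * (b * R)) := by
    have : y⁻¹ = middle Q R * w := by rw [hm, mul_assoc, w_mul_w, mul_one]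
    rw [this]
    simp [middle, s1Conj, s1_eq, mul_assoc]
  have h1 := wLength_mul_le y⁻¹ (b * R)
  rw [wLength_b_mul, wLength_inv] at h1
  rw [hnew, wLength_inv_b_mul]
  omega

/-- Without cancellation at the central letters, the product starts as its first factor does. -/
theorem exists_prod_eq_of_isChain (Q : G23) (t : List G23)
    (hb : ∀ R ∈ Q :: t, ¬ StartsW (b * R))
    (hm : (Q :: t).IsChain fun Q R =>
      middle Q R ≠ 1 ∧ ¬ StartsW (middle Q R) ∧ ¬ StartsW (middle Q R)⁻¹) :
    ∃ y, ¬ StartsW y ∧ ((Q :: t).map s1Conj).prod = Q⁻¹ * b * w * y := by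
  induction t generalizing Q with
  | nil => exact ⟨b * Q, hb Q (by simp), by simp [s1Conj, s1_eq, mul_assoc]⟩
  | cons R t ih =>
    rw [List.isChain_cons_cons] at hm
    obtain ⟨y, hy, hprod⟩ := ih R (fun S hS => hb S (List.mem_cons_of_mem _ hS)) hm.2
    refine ⟨middle Q R * w * y, not_startsW_mul_w_mul hm.1.1 hm.1.2.1 hm.1.2.2 hy, ?_⟩
    rw [List.map_cons, List.prod_cons, hprod]
    simp [middle, s1Conj, s1_eq, mul_assoc]

theorem exists_hurwitzEquiv_bPow_pair (Qs : List G23) (hprod : (Qs.map s1Conj).prod = b) :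
    ∃ p k t, HurwitzEquiv (Qs.map s1Conj) (p ++ s1Conj (b * bPow k) :: s1Conj (bPow k) :: t) := by
  induction hn : (Qs.map wLength).sum using Nat.strong_induction_on generalizing Qs with
  | _ n ih =>
    have hreplace : ∀ p Q Q' t, Qs = p ++ Q :: t → s1Conj Q' = s1Conj Q →
        wLength Q' < wLength Q →
        ∃ p k t, HurwitzEquiv (Qs.map s1Conj)
          (p ++ s1Conj (b * bPow k) :: s1Conj (bPow k) :: t) := by
      rintro p Q Q' t rfl hQ hlt
      have hmap : (p ++ Q :: t).map s1Conj = (p ++ Q' :: t).map s1Conj := by simp [hQ]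
      rw [hmap] at hprod ⊢
      exact ih _ (by simp at hn ⊢; omega) _ hprod rfl
    have hmove : ∀ Qs' : List G23, HurwitzMove (Qs.map s1Conj) (Qs'.map s1Conj) →
        (Qs'.map wLength).sum < (Qs.map wLength).sum →
        ∃ p k t, HurwitzEquiv (Qs.map s1Conj)
          (p ++ s1Conj (b * bPow k) :: s1Conj (bPow k) :: t) := by
      intro Qs' hQs' hlt
      obtain ⟨p, k, t, h⟩ := ih _ (hn ▸ hlt) Qs' (hQs'.prod_eq.trans hprod) rfl
      exact ⟨p, k, t, .head hQs' h⟩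
    by_cases hb : ∃ Q ∈ Qs, StartsW (b * Q)
    · obtain ⟨Q, hQ, hbQ⟩ := hb
      obtain ⟨p, t, hpt⟩ := List.append_of_mem hQ
      exact hreplace p Q _ t hpt (s1Conj_s1_mul Q) (wLength_s1_mul_lt hbQ)
    by_cases hb' : ∃ Q ∈ Qs, StartsW (b⁻¹ * Q)
    · obtain ⟨Q, hQ, hbQ⟩ := hb'
      obtain ⟨p, t, hpt⟩ := List.append_of_mem hQ
      exact hreplace p Q _ t hpt (s1Conj_inv_s1_mul Q) (wLength_inv_s1_mul_lt hbQ)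
    push Not at hb hb'
    by_cases hc : Qs.IsChain fun Q R =>
        middle Q R ≠ 1 ∧ ¬ StartsW (middle Q R) ∧ ¬ StartsW (middle Q R)⁻¹
    · exfalso
      rcases Qs with _ | ⟨Q, t⟩
      · have h1 : (1 : ZMod 3) = 0 := by
          have := congrArg (fun g => act g (node 0 [])) hprod
          simp only [List.map_nil, List.prod_nil, ← bPow_one, act_bPow, act_one, bAct] at this
          injection this with this
          simpa using this.symm
        exact absurd h1 (by decide)
      · obtain ⟨y, hy, hp⟩ := exists_prod_eq_of_isChain Q t hb hc
        have := wLength_mul_w_mul (x := Q⁻¹ * b) (by simpa using hb' Q (by simp)) hy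
        rw [← hp, hprod, wLength_b] at this
        omega
    rw [List.isChain_iff_forall_rel_of_append_cons_cons] at hc
    push Not at hc
    obtain ⟨Q, R, p, t, rfl, hQR⟩ := hc
    by_cases h1 : StartsW (middle Q R)
    · have hlt := wLength_mul_inv_s1Conj_lt (hb Q (by simp)) h1
      refine hmove (p ++ R * (s1Conj Q)⁻¹ :: Q :: t)
        ⟨p.map s1Conj, s1Conj Q, s1Conj R, t.map s1Conj, by simp, .inr ?_⟩ ?_
      · simp [s1Conj, mul_assoc]
      · simp only [List.map_append, List.map_cons, List.sum_append, List.sum_cons]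
        omega
    by_cases h2 : StartsW (middle Q R)⁻¹
    · have hlt := wLength_mul_s1Conj_lt (hb' R (by simp)) h2
      refine hmove (p ++ R :: Q * s1Conj R :: t)
        ⟨p.map s1Conj, s1Conj Q, s1Conj R, t.map s1Conj, by simp, .inl ?_⟩ ?_
      · simp [s1Conj, mul_assoc]
      · simp only [List.map_append, List.map_cons, List.sum_append, List.sum_cons]
        omega
    have hm : middle Q R = 1 := by tauto
    have hQ : Q = b * R := by
      calc Q = b⁻¹ * middle Q R * b⁻¹ * R := by simp [middle, mul_assoc]
        _ = b * R := by rw [hm, mul_one, inv_b_mul_inv_b]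
    have hR : ¬ StartsW R := by
      have := hb' Q (by simp)
      rwa [hQ, inv_mul_cancel_left] at this
    obtain ⟨k, rfl⟩ := exists_eq_bPow hR (hb R (by simp)) (hb' R (by simp))
    subst hQ
    exact ⟨p.map s1Conj, k, t.map s1Conj, by simpa using .refl⟩

theorem s1Conj_b_mul_mul_s1Conj (R : G23) : s1Conj (b * R) * s1Conj R = R⁻¹ * b * R := by
  simp [s1Conj, s1_eq, mul_assoc, b_mul_b_mul, w_mul_w_mul]

theorem s0_eq_s1Conj : s0 = s1Conj b := by
  simp [s0, s1Conj, s1_eq, pow_two, mul_assoc]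

theorem s1_eq_s1Conj : s1 = s1Conj 1 := by
  simp [s1Conj]

theorem s0_mul_s1 : s0 * s1 = b := by
  simpa [s0_eq_s1Conj, s1_eq_s1Conj] using s1Conj_b_mul_mul_s1Conj 1

/-- A Hurwitz move rotates the pairs with product `b`. -/
theorem hurwitzMove_bPow_pair (k : ZMod 3) (t : List G23) :
    HurwitzMove (s1Conj (b * bPow k) :: s1Conj (bPow k) :: t)
      (s1Conj (b * bPow (k + 1)) :: s1Conj (bPow (k + 1)) :: t) := by
  refine ⟨[], _, _, t, rfl, .inr ?_⟩
  have hcomm : bPow (k + 1) = b * bPow k := by rw [add_comm, bPow_add, bPow_one]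
  have hconj : s1Conj (b * (b * bPow k)) =
      s1Conj (b * bPow k) * s1Conj (bPow k) * (s1Conj (b * bPow k))⁻¹ := by
    rw [eq_mul_inv_iff_mul_eq, s1Conj_b_mul_mul_s1Conj, s1Conj_b_mul_mul_s1Conj]
    simp [mul_assoc]
  rw [hcomm, hconj, List.nil_append]

theorem hurwitzEquiv_s0_s1 (k : ZMod 3) (t : List G23) :
    HurwitzEquiv (s1Conj (b * bPow k) :: s1Conj (bPow k) :: t) (s0 :: s1 :: t) := by
  have h0 : HurwitzEquiv (s1Conj (b * bPow 0) :: s1Conj (bPow 0) :: t) (s0 :: s1 :: t) := by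
    rw [bPow_zero, mul_one, ← s0_eq_s1Conj, ← s1_eq_s1Conj]
    exact .refl
  have h2 := Relation.ReflTransGen.head (hurwitzMove_bPow_pair 2 t) h0
  have h1 := Relation.ReflTransGen.head (hurwitzMove_bPow_pair 1 t) h2
  have hk : ∀ k : ZMod 3, k = 0 ∨ k = 1 ∨ k = 2 := by decide
  rcases hk k with rfl | rfl | rfl
  exacts [h0, h1, h2]

/-- **`PSL(2,ℤ)` normal factorization, Kodaira type II.**  If `s₀s₁ = g₁⋯g_r` with each `gᵢ` a conjugate of `s₁`, then `r ≥ 2` and Hurwitz moves transform `(g₁,…,g_r)` into a sequence of conjugates of `s₁` beginning `s₀, s₁` with the remaining terms multiplying to `1`. -/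
theorem psl_normal_factorization_II (L : List G23)
    (hconj : ∀ g ∈ L, IsConj s1 g)
    (hprod : L.prod = s0 * s1) :
    2 ≤ L.length ∧
    ∃ L' : List G23, HurwitzEquiv L L' ∧ (∀ g ∈ L', IsConj s1 g) ∧
      L'.take 2 = [s0, s1] ∧ (L'.drop 2).prod = 1 := by
  have hrange : ∀ g ∈ L, ∃ Q, s1Conj Q = g := by
    intro g hg
    obtain ⟨c, hc⟩ := isConj_iff.1 (hconj g hg)
    exact ⟨c⁻¹, by rw [s1Conj, inv_inv, hc]⟩
  obtain ⟨Qs, rfl⟩ : ∃ Qs : List G23, Qs.map s1Conj = L := by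
    have : L ∈ Set.range (List.map s1Conj) := by
      rw [Set.range_list_map]; exact hrange
    exact this
  obtain ⟨p, k, t, h⟩ := exists_hurwitzEquiv_bPow_pair Qs (hprod.trans s0_mul_s1)
  have h := h.trans (hurwitzEquiv_move_front p _ _)
  have h := h.trans ((hurwitzEquiv_move_front _ _ t).cons _)
  have h := h.trans (hurwitzEquiv_s0_s1 k _)
  refine ⟨?_, _, h, HurwitzEquiv.forall_isConj h hconj, rfl, ?_⟩
  · rw [← HurwitzEquiv.length_eq h]
    simp
  · have := HurwitzEquiv.prod_eq h
    rw [hprod, List.prod_cons, List.prod_cons, ← mul_assoc, mul_eq_left] at this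
    exact this
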